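/- On the round $n$-sphere, the case $k=2$ of the GJMS commutator identity holds: for all smooth $u$, $\sum_{i=0}^n x^i\big[ L_4(x^i u) - x^i L_4 u\big] = 2(n+2)\Big(-\Delta + \tfrac{n(n-2)}{4}\Big)u$, where $L_4 = \prod_{j=1}^2\big(-\Delta+\tfrac{(n-2j)(n+2j-2)}{4}\big) = \big(-\Delta+\tfrac{n(n-2)}{4}\big)\big(-\Delta+\tfrac{(n-4)(n+2)}{4}\big)$. -/

import Mathlib

/-!
Functions on the round sphere `S^n ⊂ ℝ^{n+1}` (sectional curvature one) are
represented by their 0-homogeneous extensions to `ℝ^{n+1} \ {0}`.  For such an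
extension `u`, the Euclidean Laplacian evaluated on the unit sphere is the
Laplace–Beltrami operator of the round metric applied to `u|_{S^n}`.
-/

noncomputable section

open scoped RealInnerProductSpace

abbrev Euc (n : ℕ) := EuclideanSpace ℝ (Fin (n + 1))

/-- Radial projection to the unit sphere. -/
def sphProj {n : ℕ} (y : Euc n) : Euc n := ‖y‖⁻¹ • y

/-- `u` is (the 0-homogeneous extension of) a smooth function on `S^n`:
smooth away from the origin and invariant under positive dilations. -/
def IsSphFun {n : ℕ} (u : Euc n → ℝ) : Prop :=
  ContDiffOn ℝ (⊤ : ℕ∞) u {y | y ≠ 0} ∧ ∀ c : ℝ, 0 < c → ∀ y, u (c • y) = u y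

def pd {n : ℕ} (i : Fin (n + 1)) (f : Euc n → ℝ) : Euc n → ℝ :=
  fun y => fderiv ℝ f y (EuclideanSpace.single i 1)

/-- Euclidean Laplacian on `ℝ^{n+1}`. -/
def eucLap {n : ℕ} (f : Euc n → ℝ) : Euc n → ℝ :=
  fun y => ∑ i, pd i (pd i f) y

/-- The Laplace–Beltrami operator of the round sphere, acting on 0-homogeneous
extensions (and extended 0-homogeneously). -/
def sLap {n : ℕ} (f : Euc n → ℝ) : Euc n → ℝ :=
  fun y => eucLap f (sphProj y)

/-- `|∇ u|²` on the sphere (for 0-homogeneous `u` the spherical gradient on the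
unit sphere is the Euclidean gradient of the extension). -/
def sGrad2 {n : ℕ} (u : Euc n → ℝ) : Euc n → ℝ :=
  fun y => ∑ i, (pd i u (sphProj y)) ^ 2

/-- `⟨∇ x, ∇ u⟩` on the sphere: the derivative of `u` along the spherical
gradient of `x`. -/
def sGradPair {n : ℕ} (x u : Euc n → ℝ) : Euc n → ℝ :=
  fun y => ∑ i, pd i x (sphProj y) * pd i u (sphProj y)

/-- The i-th coordinate function of `ℝ^{n+1}` restricted to the sphere
(a first spherical harmonic), extended 0-homogeneously. -/
def sCoord {n : ℕ} (i : Fin (n + 1)) : Euc n → ℝ :=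
  fun y => sphProj y i

/-- The GJMS operator `L_{2k} = ∏_{j=1}^k (-Δ + (n-2j)(n+2j-2)/4)` on the round
`n`-sphere; `L_0 = id`. -/
def gjms (n : ℕ) : ℕ → (Euc n → ℝ) → Euc n → ℝ
  | 0, u => u
  | k + 1, u => fun y =>
      -(sLap (gjms n k u) y) +
        (((n : ℝ) - 2 * (k + 1)) * ((n : ℝ) + 2 * (k + 1) - 2) / 4) * gjms n k u y


/-- `L₂ = -Δ + n(n-2)/4`. -/
def confLap (n : ℕ) (u : Euc n → ℝ) : Euc n → ℝ :=
  fun y => -(sLap u y) + ((n : ℝ) * ((n : ℝ) - 2) / 4) * u y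

/-- The Paneitz operator on the round sphere,
`L₄ = (-Δ + n(n-2)/4)(-Δ + (n-4)(n+2)/4)`. -/
def paneitz (n : ℕ) (u : Euc n → ℝ) : Euc n → ℝ :=
  confLap n fun y =>
    -(sLap u y) + (((n : ℝ) - 4) * ((n : ℝ) + 2) / 4) * u y

section SphereFunctions

variable {n : ℕ} {f g u v : Euc n → ℝ}

lemma eventually_ne_zero {y : Euc n} (hy : y ≠ 0) : ∀ᶠ z in nhds y, z ≠ 0 :=
  isOpen_ne.mem_nhds hy

/-- Smoothness on the complement of the origin. -/
def SmoothOffZero (f : Euc n → ℝ) : Prop :=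
  ContDiffOn ℝ (⊤ : ℕ∞) f {y | y ≠ 0}

lemma SmoothOffZero.contDiffAt (hf : SmoothOffZero f) {y : Euc n} (hy : y ≠ 0) :
    ContDiffAt ℝ (⊤ : ℕ∞) f y :=
  ContDiffOn.contDiffAt hf (isOpen_ne.mem_nhds hy)

lemma SmoothOffZero.differentiableAt (hf : SmoothOffZero f) {y : Euc n} (hy : y ≠ 0) :
    DifferentiableAt ℝ f y :=
  (hf.contDiffAt hy).differentiableAt (by simp)

lemma SmoothOffZero.of_contDiffAt (h : ∀ y : Euc n, y ≠ 0 → ContDiffAt ℝ (⊤ : ℕ∞) f y) :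
    SmoothOffZero f :=
  fun y hy => (h y hy).contDiffWithinAt

lemma SmoothOffZero.pd (hf : SmoothOffZero f) (i : Fin (n + 1)) : SmoothOffZero (pd i f) :=
  .of_contDiffAt fun _ hy =>
    ((hf.contDiffAt hy).fderiv_right (m := (⊤ : ℕ∞)) (by simp)).clm_apply contDiffAt_const

lemma SmoothOffZero.mul (hf : SmoothOffZero f) (hg : SmoothOffZero g) :
    SmoothOffZero (fun y => f y * g y) :=
  ContDiffOn.mul hf hg

lemma SmoothOffZero.add (hf : SmoothOffZero f) (hg : SmoothOffZero g) :
    SmoothOffZero (fun y => f y + g y) :=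
  ContDiffOn.add hf hg

lemma SmoothOffZero.const_mul (c : ℝ) (hf : SmoothOffZero f) :
    SmoothOffZero (fun y => c * f y) :=
  ContDiffOn.mul contDiffOn_const hf

lemma SmoothOffZero.sum {ι : Type*} {s : Finset ι} {F : ι → Euc n → ℝ}
    (hF : ∀ j, SmoothOffZero (F j)) : SmoothOffZero (fun y => ∑ j ∈ s, F j y) :=
  ContDiffOn.sum fun j _ => hF j

lemma sphProj_ne_zero {y : Euc n} (hy : y ≠ 0) : sphProj y ≠ 0 :=
  smul_ne_zero (inv_ne_zero (norm_ne_zero_iff.2 hy)) hy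

lemma norm_sphProj {y : Euc n} (hy : y ≠ 0) : ‖sphProj y‖ = 1 := by
  rw [sphProj, norm_smul, norm_inv, norm_norm, inv_mul_cancel₀ (norm_ne_zero_iff.2 hy)]

lemma sphProj_of_norm_eq_one {y : Euc n} (hy : ‖y‖ = 1) : sphProj y = y := by
  simp [sphProj, hy]

lemma sphProj_smul {c : ℝ} (hc : 0 < c) (y : Euc n) : sphProj (c • y) = sphProj y := by
  rw [sphProj, sphProj, norm_smul, Real.norm_of_nonneg hc.le, smul_smul, mul_inv,
    mul_right_comm, inv_mul_cancel₀ hc.ne', one_mul]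

lemma contDiffAt_sphProj {y : Euc n} (hy : y ≠ 0) :
    ContDiffAt ℝ (⊤ : ℕ∞) (sphProj : Euc n → Euc n) y :=
  ((contDiffAt_norm ℝ hy).inv (norm_ne_zero_iff.2 hy)).smul contDiffAt_id

lemma SmoothOffZero.comp_sphProj (hf : SmoothOffZero f) :
    SmoothOffZero (fun y => f (sphProj y)) :=
  .of_contDiffAt fun y hy =>
    ContDiffAt.comp y (hf.contDiffAt (sphProj_ne_zero hy)) (contDiffAt_sphProj hy)

lemma SmoothOffZero.isSphFun_comp_sphProj (hf : SmoothOffZero f) :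
    IsSphFun (fun y => f (sphProj y)) :=
  ⟨hf.comp_sphProj, fun c hc y => by simp only [sphProj_smul hc]⟩

lemma IsSphFun.smooth (hu : IsSphFun u) : SmoothOffZero u := hu.1

lemma IsSphFun.apply_sphProj (hu : IsSphFun u) {y : Euc n} (hy : y ≠ 0) :
    u (sphProj y) = u y :=
  hu.2 _ (inv_pos.2 (norm_pos_iff.2 hy)) y

lemma IsSphFun.mul (hu : IsSphFun u) (hv : IsSphFun v) : IsSphFun (fun y => u y * v y) :=
  ⟨hu.smooth.mul hv.smooth, fun c hc y => by simp only [hu.2 c hc, hv.2 c hc]⟩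

lemma smoothOffZero_coord (i : Fin (n + 1)) : SmoothOffZero (fun y : Euc n => y i) :=
  (contDiff_piLp_apply 2 (i := i)).contDiffOn

lemma isSphFun_sCoord (i : Fin (n + 1)) : IsSphFun (sCoord i : Euc n → ℝ) :=
  (smoothOffZero_coord i).isSphFun_comp_sphProj

lemma SmoothOffZero.eucLap (hf : SmoothOffZero f) : SmoothOffZero (eucLap f) :=
  .sum fun i => (hf.pd i).pd i

lemma SmoothOffZero.isSphFun_sLap (hf : SmoothOffZero f) : IsSphFun (sLap f) :=
  hf.eucLap.isSphFun_comp_sphProj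

lemma pd_congr (h : ∀ y : Euc n, y ≠ 0 → f y = g y) (i : Fin (n + 1)) {y : Euc n} (hy : y ≠ 0) :
    pd i f y = pd i g y := by
  have : f =ᶠ[nhds y] g := (eventually_ne_zero hy).mono h
  rw [pd, pd, this.fderiv_eq]

lemma eucLap_congr (h : ∀ y : Euc n, y ≠ 0 → f y = g y) {y : Euc n} (hy : y ≠ 0) :
    eucLap f y = eucLap g y :=
  Finset.sum_congr rfl fun i _ => pd_congr (fun _ => pd_congr h i) i hy

lemma sLap_congr (h : ∀ y : Euc n, y ≠ 0 → f y = g y) {y : Euc n} (hy : y ≠ 0) :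
    sLap f y = sLap g y :=
  eucLap_congr h (sphProj_ne_zero hy)

lemma pd_add (hf : SmoothOffZero f) (hg : SmoothOffZero g) (i : Fin (n + 1)) {y : Euc n}
    (hy : y ≠ 0) : pd i (fun z => f z + g z) y = pd i f y + pd i g y := by
  simp only [pd]
  rw [fderiv_fun_add (hf.differentiableAt hy) (hg.differentiableAt hy)]
  rfl

lemma pd_const_mul (c : ℝ) (hf : SmoothOffZero f) (i : Fin (n + 1)) {y : Euc n}
    (hy : y ≠ 0) : pd i (fun z => c * f z) y = c * pd i f y := by
  simp only [pd]
  rw [fderiv_const_mul (hf.differentiableAt hy)]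
  rfl

lemma pd_mul (hf : SmoothOffZero f) (hg : SmoothOffZero g) (i : Fin (n + 1)) {y : Euc n}
    (hy : y ≠ 0) : pd i (fun z => f z * g z) y = f y * pd i g y + g y * pd i f y := by
  simp only [pd]
  rw [fderiv_fun_mul (hf.differentiableAt hy) (hg.differentiableAt hy)]
  rfl

lemma eucLap_add (hf : SmoothOffZero f) (hg : SmoothOffZero g) {y : Euc n} (hy : y ≠ 0) :
    eucLap (fun z => f z + g z) y = eucLap f y + eucLap g y := by
  simp only [eucLap, ← Finset.sum_add_distrib]
  refine Finset.sum_congr rfl fun i _ => ?_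
  rw [pd_congr (fun _ => pd_add hf hg i) i hy, pd_add (hf.pd i) (hg.pd i) i hy]

lemma eucLap_const_mul (c : ℝ) (hf : SmoothOffZero f) {y : Euc n} (hy : y ≠ 0) :
    eucLap (fun z => c * f z) y = c * eucLap f y := by
  simp only [eucLap, Finset.mul_sum]
  refine Finset.sum_congr rfl fun i _ => ?_
  rw [pd_congr (fun _ => pd_const_mul c hf i) i hy, pd_const_mul c (hf.pd i) i hy]

lemma eucLap_mul (hf : SmoothOffZero f) (hg : SmoothOffZero g) {y : Euc n} (hy : y ≠ 0) :
    eucLap (fun z => f z * g z) y =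
      f y * eucLap g y + g y * eucLap f y + 2 * ∑ i, pd i f y * pd i g y := by
  simp only [eucLap, Finset.mul_sum, ← Finset.sum_add_distrib]
  refine Finset.sum_congr rfl fun i _ => ?_
  rw [pd_congr (fun _ => pd_mul hf hg i) i hy,
    pd_add (hf.mul (hg.pd i)) (hg.mul (hf.pd i)) i hy,
    pd_mul hf (hg.pd i) i hy, pd_mul hg (hf.pd i) i hy]
  ring

lemma sLap_add (hf : SmoothOffZero f) (hg : SmoothOffZero g) {y : Euc n} (hy : y ≠ 0) :
    sLap (fun z => f z + g z) y = sLap f y + sLap g y :=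
  eucLap_add hf hg (sphProj_ne_zero hy)

lemma sLap_const_mul (c : ℝ) (hf : SmoothOffZero f) {y : Euc n} (hy : y ≠ 0) :
    sLap (fun z => c * f z) y = c * sLap f y :=
  eucLap_const_mul c hf (sphProj_ne_zero hy)

lemma sLap_zero (y : Euc n) : sLap (fun _ => 0) y = 0 := by
  have h : ∀ i : Fin (n + 1), pd i (fun _ => (0 : ℝ)) = fun _ => 0 := fun i => by
    funext z
    simp [pd]
  simp [sLap, eucLap, h]

lemma sLap_finset_sum {ι : Type*} (s : Finset ι) {F : ι → Euc n → ℝ}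
    (hF : ∀ j, SmoothOffZero (F j)) {y : Euc n} (hy : y ≠ 0) :
    sLap (fun z => ∑ j ∈ s, F j z) y = ∑ j ∈ s, sLap (F j) y := by
  classical
  induction s using Finset.induction_on with
  | empty => simp [sLap_zero]
  | insert a s ha ih =>
    simp only [Finset.sum_insert ha]
    rw [sLap_add (hF a) (.sum hF) hy, ih]

lemma smoothOffZero_norm : SmoothOffZero (fun y : Euc n => ‖y‖) :=
  .of_contDiffAt fun _ hy => contDiffAt_norm ℝ hy

lemma smoothOffZero_norm_inv : SmoothOffZero (fun y : Euc n => ‖y‖⁻¹) :=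
  .of_contDiffAt fun _ hy => (contDiffAt_norm ℝ hy).inv (norm_ne_zero_iff.2 hy)

lemma pd_coord (i j : Fin (n + 1)) (y : Euc n) :
    pd j (fun z : Euc n => z i) y = if i = j then 1 else 0 := by
  have h : HasFDerivAt (fun z : Euc n => z i) (EuclideanSpace.proj i : Euc n →L[ℝ] ℝ) y :=
    (EuclideanSpace.proj i : Euc n →L[ℝ] ℝ).hasFDerivAt
  simp [pd, h.fderiv]

lemma sum_sq_eq_norm_sq (y : Euc n) : ∑ i, y i * y i = ‖y‖ ^ 2 := by
  simp only [EuclideanSpace.real_norm_sq_eq, ← pow_two]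

lemma pd_norm (i : Fin (n + 1)) {y : Euc n} (hy : y ≠ 0) :
    pd i (fun z : Euc n => ‖z‖) y = ‖y‖⁻¹ * y i := by
  have h0 : ‖y‖ ≠ 0 := norm_ne_zero_iff.2 hy
  have h1 : pd i (fun z : Euc n => ‖z‖ * ‖z‖) y = 2 * y i := by
    have h := (hasStrictFDerivAt_norm_sq y).hasFDerivAt
    simp only [pd, ← pow_two]
    rw [h.fderiv]
    simp [EuclideanSpace.inner_single_right]
  rw [pd_mul smoothOffZero_norm smoothOffZero_norm i hy] at h1
  field_simp
  linarith

lemma pd_norm_inv (i : Fin (n + 1)) {y : Euc n} (hy : y ≠ 0) :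
    pd i (fun z : Euc n => ‖z‖⁻¹) y = -(‖y‖⁻¹ * (‖y‖⁻¹ * (‖y‖⁻¹ * y i))) := by
  have h0 : ‖y‖ ≠ 0 := norm_ne_zero_iff.2 hy
  have h1 : pd i (fun z : Euc n => ‖z‖ * ‖z‖⁻¹) y = 0 := by
    rw [pd_congr (g := fun _ => 1) (fun z hz => mul_inv_cancel₀ (norm_ne_zero_iff.2 hz)) i hy]
    simp [pd]
  rw [pd_mul smoothOffZero_norm smoothOffZero_norm_inv i hy, pd_norm i hy] at h1
  field_simp at h1 ⊢
  linarith

lemma sCoord_eq (i : Fin (n + 1)) (y : Euc n) : sCoord i y = ‖y‖⁻¹ * y i := by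
  simp [sCoord, sphProj]

lemma pd_sCoord (i j : Fin (n + 1)) {y : Euc n} (hy : y ≠ 0) :
    pd j (sCoord i) y =
      ‖y‖⁻¹ * ((if i = j then 1 else 0) + (-1) * (sCoord i y * sCoord j y)) := by
  have h : (sCoord i : Euc n → ℝ) = fun z => ‖z‖⁻¹ * z i := funext (sCoord_eq i)
  rw [h, pd_mul smoothOffZero_norm_inv (smoothOffZero_coord i) j hy, pd_coord, pd_norm_inv j hy,
    sCoord_eq]
  ring

lemma sum_sCoord_mul_self {y : Euc n} (hy : y ≠ 0) : ∑ i, sCoord i y * sCoord i y = 1 := by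
  have h := sum_sq_eq_norm_sq (sphProj y)
  rwa [norm_sphProj hy, one_pow] at h

lemma sCoord_of_norm_eq_one (i : Fin (n + 1)) {y : Euc n} (hy : ‖y‖ = 1) : sCoord i y = y i := by
  rw [sCoord, sphProj_of_norm_eq_one hy]

lemma eucLap_sCoord (i : Fin (n + 1)) {y : Euc n} (hy : ‖y‖ = 1) :
    eucLap (sCoord i) y = -(n : ℝ) * sCoord i y := by
  have h0 : y ≠ 0 := norm_ne_zero_iff.1 (by simp [hy])
  have hX := fun k : Fin (n + 1) => (isSphFun_sCoord k).smooth
  have key : ∀ j, pd j (pd j (sCoord i)) y =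
      (-2 * (if i = j then y j else 0) - y i) + 3 * y i * (y j * y j) := by
    intro j
    have hc : SmoothOffZero (fun _ : Euc n => if i = j then (1 : ℝ) else 0) := contDiffOn_const
    have hc' : pd j (fun _ : Euc n => if i = j then (1 : ℝ) else 0) y = 0 := by simp [pd]
    rw [pd_congr (fun _ => pd_sCoord i j) j h0,
      pd_mul smoothOffZero_norm_inv (hc.add (((hX i).mul (hX j)).const_mul (-1))) j h0,
      pd_add hc (((hX i).mul (hX j)).const_mul (-1)) j h0, hc',
      pd_const_mul _ ((hX i).mul (hX j)) j h0, pd_mul (hX i) (hX j) j h0, pd_norm_inv j h0,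
      pd_sCoord i j h0, pd_sCoord j j h0, sCoord_of_norm_eq_one i hy,
      sCoord_of_norm_eq_one j hy, hy]
    by_cases hij : i = j
    · subst hij; simp; ring
    · simp [hij]; ring
  rw [eucLap, Finset.sum_congr rfl fun j _ => key j, Finset.sum_add_distrib,
    Finset.sum_sub_distrib, ← Finset.mul_sum, ← Finset.mul_sum, sum_sq_eq_norm_sq, hy,
    sCoord_of_norm_eq_one i hy]
  simp
  ring

/-- The derivative along the spherical gradient of the `i`-th coordinate, acting on
0-homogeneous extensions. -/
def sphPd (i : Fin (n + 1)) (f : Euc n → ℝ) : Euc n → ℝ :=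
  fun y => pd i f (sphProj y)

lemma isSphFun_sphPd (hu : IsSphFun u) (i : Fin (n + 1)) : IsSphFun (sphPd i u) :=
  (hu.smooth.pd i).isSphFun_comp_sphProj

/-- The first derivatives of a 0-homogeneous function are homogeneous of degree `-1`. -/
lemma IsSphFun.sphPd_eq (hu : IsSphFun u) (i : Fin (n + 1)) {y : Euc n} (hy : y ≠ 0) :
    sphPd i u y = ‖y‖ * pd i u y := by
  have h0 : ‖y‖ ≠ 0 := norm_ne_zero_iff.2 hy
  have h : (fun z => u (‖y‖⁻¹ • z)) = u := funext (hu.2 _ (inv_pos.2 (norm_pos_iff.2 hy)))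
  have h1 : pd i u y = ‖y‖⁻¹ * pd i u (sphProj y) := by
    conv_lhs => rw [← h]
    rw [pd, fderiv_comp_smul]
    rfl
  rw [h1, sphPd, mul_inv_cancel_left₀ h0]

lemma fderiv_apply_self_eq_sum (f : Euc n → ℝ) (y : Euc n) :
    fderiv ℝ f y y = ∑ i, y i * pd i f y := by
  have h := (EuclideanSpace.basisFun (Fin (n + 1)) ℝ).sum_repr y
  calc fderiv ℝ f y y = fderiv ℝ f y (∑ i, y i • EuclideanSpace.single i (1 : ℝ)) := by
        congr 1
        simpa using h.symm
    _ = ∑ i, y i * pd i f y := by simp only [map_sum, map_smul, smul_eq_mul, pd]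

/-- Euler's identity for 0-homogeneous functions. -/
lemma IsSphFun.sum_coord_mul_pd (hu : IsSphFun u) {y : Euc n} (hy : y ≠ 0) :
    ∑ i, y i * pd i u y = 0 := by
  rw [← fderiv_apply_self_eq_sum]
  have h1 : HasDerivAt (fun t : ℝ => t • y) y 1 := by
    simpa using (hasDerivAt_id (1 : ℝ)).smul_const y
  have h2 : HasFDerivAt u (fderiv ℝ u y) ((1 : ℝ) • y) := by
    simpa using (hu.smooth.differentiableAt hy).hasFDerivAt
  have h3 := h2.comp_hasDerivAt (1 : ℝ) h1
  have h4 : HasDerivAt (u ∘ fun t : ℝ => t • y) 0 1 := by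
    refine (hasDerivAt_const (1 : ℝ) (u y)).congr_of_eventuallyEq ?_
    filter_upwards [lt_mem_nhds (zero_lt_one' ℝ)] with t ht
    exact hu.2 t ht y
  exact h3.unique h4

lemma IsSphFun.sum_sCoord_mul_sphPd (hu : IsSphFun u) {y : Euc n} (hy : y ≠ 0) :
    ∑ i, sCoord i y * sphPd i u y = 0 :=
  hu.sum_coord_mul_pd (sphProj_ne_zero hy)

/-- The commutator of the spherical Laplacian with a coordinate function. -/
lemma IsSphFun.sLap_sCoord_mul (hv : IsSphFun v) (i : Fin (n + 1)) {y : Euc n} (hy : y ≠ 0) :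
    sLap (fun z => sCoord i z * v z) y =
      sCoord i y * sLap v y - n * (sCoord i y * v y) + 2 * sphPd i v y := by
  have hp := sphProj_ne_zero hy
  have hn := norm_sphProj hy
  have hgrad : ∑ j, pd j (sCoord i) (sphProj y) * pd j v (sphProj y) =
      sphPd i v y := by
    have : ∀ j, pd j (sCoord i) (sphProj y) * pd j v (sphProj y) =
        (if i = j then pd j v (sphProj y) else 0) -
          sphProj y i * (sphProj y j * pd j v (sphProj y)) := by
      intro j
      rw [pd_sCoord i j hp, hn, sCoord_of_norm_eq_one i hn, sCoord_of_norm_eq_one j hn]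
      split_ifs <;> ring
    rw [Finset.sum_congr rfl fun j _ => this j, Finset.sum_sub_distrib, ← Finset.mul_sum,
      hv.sum_coord_mul_pd hp]
    simp [sphPd]
  rw [sLap, eucLap_mul (isSphFun_sCoord i).smooth hv.smooth hp, hgrad, eucLap_sCoord i hn,
    (isSphFun_sCoord i).apply_sphProj hy, hv.apply_sphProj hy, sLap]
  ring

/-- The spherical Laplacian is the sum of squares of the gradient fields of the coordinates. -/
lemma IsSphFun.sum_sphPd_sphPd (hu : IsSphFun u) {y : Euc n} (hy : y ≠ 0) :
    ∑ i, sphPd i (sphPd i u) y = sLap u y := by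
  have hp := sphProj_ne_zero hy
  have hn := norm_sphProj hy
  have : ∀ i, sphPd i (sphPd i u) y =
      pd i (pd i u) (sphProj y) + sphProj y i * pd i u (sphProj y) := by
    intro i
    change pd i (sphPd i u) (sphProj y) = _
    rw [pd_congr (fun _ => hu.sphPd_eq i) i hp, pd_mul smoothOffZero_norm (hu.smooth.pd i) i hp,
      pd_norm i hp, hn]
    ring
  rw [Finset.sum_congr rfl fun i _ => this i, Finset.sum_add_distrib, hu.sum_coord_mul_pd hp,
    add_zero, sLap, eucLap]

lemma IsSphFun.sum_sCoord_mul_sLap_sphPd (hu : IsSphFun u) {y : Euc n} (hy : y ≠ 0) :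
    ∑ i, sCoord i y * sLap (sphPd i u) y = -2 * sLap u y := by
  have h1 : ∀ i, sCoord i y * sLap (sphPd i u) y =
      sLap (fun z => sCoord i z * sphPd i u z) y + n * (sCoord i y * sphPd i u y)
        + (-2) * sphPd i (sphPd i u) y := by
    intro i
    rw [(isSphFun_sphPd hu i).sLap_sCoord_mul i hy]
    ring
  have h2 : ∑ i, sLap (fun z => sCoord i z * sphPd i u z) y = 0 := by
    rw [← sLap_finset_sum _ (fun i => ((isSphFun_sCoord i).mul (isSphFun_sphPd hu i)).smooth) hy,
      sLap_congr (g := fun _ => 0) (fun _ => hu.sum_sCoord_mul_sphPd) hy, sLap_zero]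
  rw [Finset.sum_congr rfl fun i _ => h1 i, Finset.sum_add_distrib, Finset.sum_add_distrib, h2,
    ← Finset.mul_sum, ← Finset.mul_sum, hu.sum_sCoord_mul_sphPd hy, hu.sum_sphPd_sphPd hy]
  ring

lemma IsSphFun.sLap_sLap_sCoord_mul (hu : IsSphFun u) (i : Fin (n + 1)) {y : Euc n}
    (hy : y ≠ 0) :
    sLap (sLap fun z => sCoord i z * u z) y =
      sCoord i y * sLap (sLap u) y - 2 * n * (sCoord i y * sLap u y)
        + n ^ 2 * (sCoord i y * u y) + 2 * sphPd i (sLap u) y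
        - 2 * n * sphPd i u y + 2 * sLap (sphPd i u) y := by
  have hXu := (isSphFun_sCoord i).mul hu
  have hS := hu.smooth.isSphFun_sLap
  have hXS := (isSphFun_sCoord i).mul hS
  rw [sLap_congr (g := fun z => (sCoord i z * sLap u z + -(n : ℝ) * (sCoord i z * u z))
      + 2 * sphPd i u z)
      (fun z hz => by rw [hu.sLap_sCoord_mul i hz]; ring) hy,
    sLap_add (hXS.smooth.add (hXu.smooth.const_mul _)) ((isSphFun_sphPd hu i).smooth.const_mul _) hy,
    sLap_add hXS.smooth (hXu.smooth.const_mul _) hy, sLap_const_mul _ hXu.smooth hy,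
    sLap_const_mul _ (isSphFun_sphPd hu i).smooth hy, hS.sLap_sCoord_mul i hy, hu.sLap_sCoord_mul i hy]
  ring

lemma SmoothOffZero.paneitz_eq (hf : SmoothOffZero f) {y : Euc n} (hy : y ≠ 0) :
    paneitz n f y = sLap (sLap f) y - (((n : ℝ) ^ 2 - 2 * n - 4) / 2) * sLap f y
      + ((n : ℝ) * (n - 2) / 4) * ((n - 4) * (n + 2) / 4) * f y := by
  have hS := hf.isSphFun_sLap.smooth
  have h : (fun z => -(sLap f z) + (((n : ℝ) - 4) * ((n : ℝ) + 2) / 4) * f z) =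
      fun z => (-1) * sLap f z + (((n : ℝ) - 4) * ((n : ℝ) + 2) / 4) * f z := by
    simp
  rw [paneitz, h, confLap, sLap_add (hS.const_mul _) (hf.const_mul _) hy,
    sLap_const_mul _ hS hy, sLap_const_mul _ hf hy]
  ring

end SphereFunctions

/-- The `k = 2` case of the GJMS commutator identity:
`∑ᵢ xⁱ [L₄, xⁱ] u = 2(n+2) L₂ u`. -/
theorem paneitz_sum_commutator (n : ℕ)
    (u : Euc n → ℝ) (hu : IsSphFun u) :
    ∀ ζ : Euc n, ‖ζ‖ = 1 →
      ∑ i, sCoord i ζ *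
          (paneitz n (fun y => sCoord i y * u y) ζ - sCoord i ζ * paneitz n u ζ) =
        2 * ((n : ℝ) + 2) * confLap n u ζ := by
  intro ζ hζ
  have hy : ζ ≠ 0 := norm_ne_zero_iff.1 (by simp [hζ])
  have key : ∀ i, sCoord i ζ *
      (paneitz n (fun y => sCoord i y * u y) ζ - sCoord i ζ * paneitz n u ζ) =
      (sCoord i ζ * sCoord i ζ) *
          (-2 * n * sLap u ζ + n ^ 2 * u ζ + n * (((n : ℝ) ^ 2 - 2 * n - 4) / 2) * u ζ)
        + 2 * (sCoord i ζ * sphPd i (sLap u) ζ)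
        + (-2 * n - 2 * (((n : ℝ) ^ 2 - 2 * n - 4) / 2)) * (sCoord i ζ * sphPd i u ζ)
        + 2 * (sCoord i ζ * sLap (sphPd i u) ζ) := by
    intro i
    rw [((isSphFun_sCoord i).mul hu).smooth.paneitz_eq hy, hu.smooth.paneitz_eq hy,
      hu.sLap_sLap_sCoord_mul i hy, hu.sLap_sCoord_mul i hy]
    ring
  rw [Finset.sum_congr rfl fun i _ => key i, Finset.sum_add_distrib, Finset.sum_add_distrib,
    Finset.sum_add_distrib, ← Finset.sum_mul, ← Finset.mul_sum, ← Finset.mul_sum,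
    ← Finset.mul_sum, sum_sCoord_mul_self hy,
    hu.smooth.isSphFun_sLap.sum_sCoord_mul_sphPd hy, hu.sum_sCoord_mul_sphPd hy,
    hu.sum_sCoord_mul_sLap_sphPd hy, confLap]
  ring
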